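/- arXiv:1604.07711 — 2 statements merged into one kernel-verified Lean document; each statement's English description precedes it below -/
import Mathlib

section
/- (Mean Partition Theorem) Let 𝒮ₙ = (X₁, …, Xₙ) be a sample of n partitions and suppose M ∈ 𝒫 is a local minimum of the Fréchet function Fₙ of 𝒮ₙ (with respect to the metric δ). Then every representation M' of M is of the form M' = (1/n) Σᵢ Xᵢ', where each Xᵢ' ∈ Xᵢ is a representation of Xᵢ in optimal position with M'. -/
/-!
Partition spaces for consensus clustering (Jain, "Condorcet's Jury Theorem for
Consensus Clustering").  Labeled partitions are ℓ×m column-stochastic matrices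
with entries in [0,1]; the group Π of ℓ×ℓ permutation matrices acts by left
multiplication; partitions are orbits; δ is induced by the Frobenius norm.
-/

namespace CJT

/-- ℓ×m real matrices. -/
abbrev Mat (l m : ℕ) := Matrix (Fin l) (Fin m) ℝ

/-- `P` is an ℓ×ℓ permutation matrix. -/
def IsPermMatrix {l : ℕ} (P : Matrix (Fin l) (Fin l) ℝ) : Prop :=
  ∃ σ : Equiv.Perm (Fin l), ∀ i k, P i k = if σ i = k then 1 else 0

/-- `X` is a labeled partition: entries in `[0,1]`, columns summing to one. -/
def IsLabeled {l m : ℕ} (X : Mat l m) : Prop :=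
  (∀ i j, 0 ≤ X i j ∧ X i j ≤ 1) ∧ ∀ j, (∑ i, X i j) = 1

/-- The orbit `[X] = {P X : P ∈ Π}` of a labeled partition. -/
def orbit {l m : ℕ} (X : Mat l m) : Set (Mat l m) :=
  {Y | ∃ P : Matrix (Fin l) (Fin l) ℝ, IsPermMatrix P ∧ Y = P * X}

/-- The partition space 𝒫: all orbits of labeled partitions. -/
def PartitionSpace (l m : ℕ) : Set (Set (Mat l m)) :=
  {A | ∃ X : Mat l m, IsLabeled X ∧ A = orbit X}

/-- Frobenius (Euclidean) norm. -/
noncomputable def frobNorm {l m : ℕ} (X : Mat l m) : ℝ :=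
  Real.sqrt (∑ i, ∑ j, (X i j) ^ 2)

/-- `δ(A, B) = min {‖X' − Y'‖ : X' ∈ A, Y' ∈ B}`. -/
noncomputable def pdist {l m : ℕ} (A B : Set (Mat l m)) : ℝ :=
  sInf {d | ∃ X ∈ A, ∃ Y ∈ B, d = frobNorm (X - Y)}

/-- The Fréchet function `Fₙ(Z) = (1/n) Σᵢ δ(Xᵢ, Z)²` of a sample
`𝒮ₙ = (X₁, …, Xₙ)` of `n` partitions. -/
noncomputable def frechet {l m n : ℕ} (s : Fin n → Set (Mat l m)) (A : Set (Mat l m)) : ℝ :=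
  (1 / (n : ℝ)) * ∑ i, (pdist (s i) A) ^ 2

/-- A mean partition of the sample `s`: a global minimizer of the Fréchet
function over the partition space 𝒫. -/
def IsMeanPartition {l m n : ℕ} (s : Fin n → Set (Mat l m)) (M : Set (Mat l m)) : Prop :=
  M ∈ PartitionSpace l m ∧ ∀ W ∈ PartitionSpace l m, frechet s M ≤ frechet s W

section

variable {l m : ℕ}

theorem mem_orbit_iff {X Y : Mat l m} :
    Y ∈ orbit X ↔ ∃ σ : Equiv.Perm (Fin l), Y = X.submatrix σ id := by
  constructor
  · rintro ⟨P, ⟨σ, hσ⟩, rfl⟩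
    refine ⟨σ, ?_⟩
    ext i j
    simp [Matrix.mul_apply, hσ]
  · rintro ⟨σ, rfl⟩
    refine ⟨Matrix.of fun i k => if σ i = k then 1 else 0, ⟨σ, fun _ _ => rfl⟩, ?_⟩
    ext i j
    simp [Matrix.mul_apply]

theorem self_mem_orbit (X : Mat l m) : X ∈ orbit X :=
  mem_orbit_iff.2 ⟨1, by ext; simp⟩

theorem frobNorm_nonneg (X : Mat l m) : 0 ≤ frobNorm X := Real.sqrt_nonneg _

theorem frobNorm_sq (X : Mat l m) : frobNorm X ^ 2 = ∑ i, ∑ j, X i j ^ 2 :=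
  Real.sq_sqrt (Finset.sum_nonneg fun _ _ => Finset.sum_nonneg fun _ _ => sq_nonneg _)

theorem frobNorm_submatrix (X : Mat l m) (σ : Equiv.Perm (Fin l)) :
    frobNorm (X.submatrix σ id) = frobNorm X := by
  unfold frobNorm
  congr 1
  exact Equiv.sum_comp σ fun i => ∑ j, X i j ^ 2

theorem frobNorm_smul (t : ℝ) (X : Mat l m) : frobNorm (t • X) = |t| * frobNorm X := by
  unfold frobNorm
  simp only [Matrix.smul_apply, smul_eq_mul, mul_pow, ← Finset.mul_sum]
  rw [Real.sqrt_mul (sq_nonneg t), Real.sqrt_sq_eq_abs]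

theorem frobNorm_neg (X : Mat l m) : frobNorm (-X) = frobNorm X := by
  simp [frobNorm]

theorem eq_zero_of_frobNorm_eq_zero {X : Mat l m} (h : frobNorm X = 0) : X = 0 := by
  have hs := frobNorm_sq X
  rw [h, zero_pow two_ne_zero] at hs
  ext i j
  have hi := (Finset.sum_eq_zero_iff_of_nonneg fun i _ =>
    Finset.sum_nonneg fun j _ => sq_nonneg (X i j)).1 hs.symm i (Finset.mem_univ i)
  have hj := (Finset.sum_eq_zero_iff_of_nonneg fun j _ => sq_nonneg (X i j)).1 hi j
    (Finset.mem_univ j)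
  simpa using hj

theorem pdist_nonneg (A B : Set (Mat l m)) : 0 ≤ pdist A B :=
  Real.sInf_nonneg <| by rintro _ ⟨X, _, Y, _, rfl⟩; exact frobNorm_nonneg _

theorem pdist_le {A B : Set (Mat l m)} {X Y : Mat l m} (hX : X ∈ A) (hY : Y ∈ B) :
    pdist A B ≤ frobNorm (X - Y) :=
  csInf_le ⟨0, by rintro _ ⟨X, _, Y, _, rfl⟩; exact frobNorm_nonneg _⟩ ⟨X, hX, Y, hY, rfl⟩

/-- Every representation of one orbit has an optimally positioned partner in any other orbit. -/
theorem exists_optimal_position (X : Mat l m) {M₀ M : Mat l m} (hM : M ∈ orbit M₀) :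
    ∃ R ∈ orbit X, frobNorm (R - M) = pdist (orbit X) (orbit M₀) := by
  obtain ⟨σ, hσ⟩ := Finite.exists_min
    fun σ : Equiv.Perm (Fin l) => frobNorm (X.submatrix σ id - M)
  have hR : X.submatrix σ id ∈ orbit X := mem_orbit_iff.2 ⟨σ, rfl⟩
  refine ⟨_, hR, le_antisymm (le_csInf ⟨_, _, hR, M, hM, rfl⟩ ?_) (pdist_le hR hM)⟩
  rintro _ ⟨Y, hY, Z, hZ, rfl⟩
  obtain ⟨τ, rfl⟩ := mem_orbit_iff.1 hM
  obtain ⟨α, rfl⟩ := mem_orbit_iff.1 hY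
  obtain ⟨β, rfl⟩ := mem_orbit_iff.1 hZ
  refine (hσ (α * (β⁻¹ * τ))).trans_eq ?_
  rw [← frobNorm_submatrix (X.submatrix α id - M₀.submatrix β id) (β⁻¹ * τ)]
  congr 1
  ext i j
  simp

theorem IsLabeled.of_mem_orbit {X Y : Mat l m} (hX : IsLabeled X) (hY : Y ∈ orbit X) :
    IsLabeled Y := by
  obtain ⟨σ, rfl⟩ := mem_orbit_iff.1 hY
  exact ⟨fun i j => hX.1 (σ i) j, fun j => (Equiv.sum_comp σ fun i => X i j).trans (hX.2 j)⟩

theorem convex_isLabeled : Convex ℝ {X : Mat l m | IsLabeled X} := by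
  intro X hX Y hY a b ha hb hab
  refine ⟨fun i j => ?_, fun j => ?_⟩
  · exact convex_Icc (0 : ℝ) 1 (hX.1 i j) (hY.1 i j) ha hb hab
  · simp [Finset.sum_add_distrib, ← Finset.mul_sum, hX.2 j, hY.2 j, hab]

/-- Parallel-axis identity along the segment from `M` to the mean of the `R i`. -/
theorem sum_frobNorm_sub_sq {n : ℕ} (hn : 0 < n) (R : Fin n → Mat l m) (M A : Mat l m)
    (hA : A = (n : ℝ)⁻¹ • ∑ i, R i) (t : ℝ) :
    ∑ i, frobNorm (R i - (M + t • (A - M))) ^ 2 =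
      ∑ i, frobNorm (R i - M) ^ 2 - n * (2 * t - t ^ 2) * frobNorm (A - M) ^ 2 := by
  have hn' : (n : ℝ) ≠ 0 := by positivity
  have entry (a : Fin l) (b : Fin m) :
      ∑ i, (R i - (M + t • (A - M))) a b ^ 2 =
        ∑ i, (R i - M) a b ^ 2 - n * (2 * t - t ^ 2) * (A - M) a b ^ 2 := by
    have hsum : ∑ i, (R i - M) a b = n * (A - M) a b := by
      simp only [hA, Matrix.sub_apply, Matrix.smul_apply, Matrix.sum_apply, smul_eq_mul,
        Finset.sum_sub_distrib, Finset.sum_const, Finset.card_univ, Fintype.card_fin,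
        nsmul_eq_mul]
      field_simp
    have hexp (i : Fin n) : (R i - (M + t • (A - M))) a b ^ 2 =
        (R i - M) a b ^ 2 - 2 * t * (A - M) a b * (R i - M) a b
          + t ^ 2 * (A - M) a b ^ 2 := by
      simp only [Matrix.sub_apply, Matrix.add_apply, Matrix.smul_apply, smul_eq_mul]
      ring
    simp only [hexp, Finset.sum_add_distrib, Finset.sum_sub_distrib, ← Finset.mul_sum, hsum,
      Finset.sum_const, Finset.card_univ, Fintype.card_fin, nsmul_eq_mul]
    ring
  have swap (f : Fin n → Mat l m) :
      ∑ i, frobNorm (f i) ^ 2 = ∑ a, ∑ b, ∑ i, f i a b ^ 2 := by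
    simp only [frobNorm_sq]
    rw [Finset.sum_comm]
    exact Finset.sum_congr rfl fun _ _ => Finset.sum_comm
  rw [swap, swap, frobNorm_sq]
  simp only [entry, Finset.sum_sub_distrib, Finset.mul_sum]

end

/-- **Mean Partition Theorem.**  Let `𝒮ₙ = (X₁, …, Xₙ)` be a
sample of `n ≥ 1` partitions and suppose `M ∈ 𝒫` is a local minimum of the
Fréchet function `Fₙ` with respect to the metric δ.  Then every representation
`M'` of `M` is of the form `M' = (1/n) Σᵢ Xᵢ'`, where each `Xᵢ' ∈ Xᵢ` is a
representation of `Xᵢ` in optimal position with `M'`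
(i.e. `‖Xᵢ' − M'‖ = δ(Xᵢ, M)`). -/
theorem mean_partition_theorem (l m : ℕ) (hl : 1 ≤ l) (hm : 1 ≤ m) (n : ℕ) (hn : 0 < n)
    (s : Fin n → Set (Mat l m)) (hs : ∀ i, s i ∈ PartitionSpace l m)
    (M : Set (Mat l m)) (hM : M ∈ PartitionSpace l m)
    (hloc : ∃ ε : ℝ, 0 < ε ∧ ∀ W ∈ PartitionSpace l m,
      pdist M W < ε → frechet s M ≤ frechet s W) :
    ∀ M' ∈ M, ∃ R : Fin n → Mat l m,
      (∀ i, R i ∈ s i) ∧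
      (∀ i, frobNorm (R i - M') = pdist (s i) M) ∧
      M' = ((n : ℝ)⁻¹) • ∑ i, R i := by
  intro M' hM'
  obtain ⟨ε, hε, hmin⟩ := hloc
  obtain ⟨M₀, hM₀, rfl⟩ := hM
  choose X hX hsX using hs
  choose R hR hopt using fun i => exists_optimal_position (X i) hM'
  have hRs (i : Fin n) : R i ∈ s i := hsX i ▸ hR i
  have hRopt (i : Fin n) : frobNorm (R i - M') = pdist (s i) (orbit M₀) := by
    rw [hsX i]
    exact hopt i
  refine ⟨R, hRs, hRopt, ?_⟩
  set A : Mat l m := (n : ℝ)⁻¹ • ∑ i, R i with hA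
  have hn' : (0 : ℝ) < n := by exact_mod_cast hn
  have hAlab : IsLabeled A := by
    rw [hA, Finset.smul_sum]
    refine convex_isLabeled.sum_mem (fun _ _ => by positivity) ?_
      fun i _ => (hX i).of_mem_orbit (hR i)
    simp [hn'.ne']
  set d := frobNorm (A - M') with hd
  have hd0 : 0 ≤ d := frobNorm_nonneg _
  obtain ⟨t, ht0, ht1, htε⟩ : ∃ t : ℝ, 0 < t ∧ t ≤ 1 ∧ t * d < ε := by
    refine ⟨min 1 (ε / (d + 1)), by positivity, min_le_left _ _, ?_⟩
    calc min 1 (ε / (d + 1)) * d ≤ ε / (d + 1) * d := by gcongr; exact min_le_right _ _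
      _ < ε / (d + 1) * (d + 1) := by gcongr; linarith
      _ = ε := by field_simp
  set C : Mat l m := M' + t • (A - M') with hC
  have hClab : IsLabeled C :=
    convex_isLabeled.add_smul_sub_mem (hM₀.of_mem_orbit hM') hAlab ⟨ht0.le, ht1⟩
  have hclose : pdist (orbit M₀) (orbit C) < ε := by
    refine (pdist_le hM' (self_mem_orbit C)).trans_lt ?_
    have hsub : M' - C = -(t • (A - M')) := by rw [hC]; abel
    rwa [hsub, frobNorm_neg, frobNorm_smul, abs_of_pos ht0]
  have hF := hmin _ ⟨C, hClab, rfl⟩ hclose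
  unfold frechet at hF
  replace hF := le_of_mul_le_mul_left hF (by positivity)
  have hle : ∑ i, pdist (s i) (orbit C) ^ 2 ≤ ∑ i, frobNorm (R i - C) ^ 2 := by
    refine Finset.sum_le_sum fun i _ => ?_
    exact pow_le_pow_left₀ (pdist_nonneg _ _) (pdist_le (hRs i) (self_mem_orbit C)) 2
  have hid := sum_frobNorm_sub_sq hn R M' A hA t
  simp only [← hC, ← hd, hRopt] at hid
  have hcoef : 0 < (n : ℝ) * (2 * t - t ^ 2) := mul_pos hn' (by nlinarith)
  have hdsq : d ^ 2 ≤ 0 := by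
    by_contra! h
    linarith [mul_pos hcoef h]
  have hdz : d = 0 := pow_eq_zero_iff two_ne_zero |>.1 (le_antisymm hdsq (sq_nonneg d))
  exact (sub_eq_zero.1 (eq_zero_of_frobNorm_eq_zero hdz)).symm

end CJT
end

section
/- Let Z' be a representation of an asymmetric partition Z and let D_{Z'} = {X ∈ 𝒳 : ‖X − Z'‖ ≤ ‖X − P Z'‖ for all P ∈ Π} be the Dirichlet fundamental domain of Z'. If X' and X'' are two distinct representations of the same partition X and both lie in D_{Z'}, then both X' and X'' lie in the boundary ∂D_{Z'} (relative to the subspace topology on 𝒳). -/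
/-!
Partition spaces for consensus clustering (Jain, "Condorcet's Jury Theorem for
Consensus Clustering").  Labeled partitions are ℓ×m column-stochastic matrices
with entries in [0,1]; the group Π of ℓ×ℓ permutation matrices acts by left
multiplication; partitions are orbits; δ is induced by the Frobenius norm.
-/

namespace CJT

/-- The degree of asymmetry
`α_Z = min {‖Z' − P Z'‖ : Z' ∈ Z, P ∈ Π, P ≠ I}` of a partition `Z`. -/
noncomputable def asym {l m : ℕ} (A : Set (Mat l m)) : ℝ :=
  sInf {d | ∃ Z' ∈ A, ∃ P : Matrix (Fin l) (Fin l) ℝ,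
    IsPermMatrix P ∧ P ≠ 1 ∧ d = frobNorm (Z' - P * Z')}

/-- The set 𝒳 of labeled partitions, as a topological subspace of the space of
ℓ×m matrices. -/
abbrev LabeledSpace (l m : ℕ) := {X : Mat l m // IsLabeled X}

/-- The Dirichlet fundamental domain of a representation `Z'`, viewed inside 𝒳:
`D_{Z'} = {X ∈ 𝒳 : ‖X − Z'‖ ≤ ‖X − P Z'‖ for all P ∈ Π}`. -/
def dirichlet {l m : ℕ} (Z' : Mat l m) : Set (LabeledSpace l m) :=
  {X | ∀ P : Matrix (Fin l) (Fin l) ℝ, IsPermMatrix P →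
    frobNorm (X.1 - Z') ≤ frobNorm (X.1 - P * Z')}

/-- The Frobenius inner product. -/
def frobInner {l m : ℕ} (X Y : Mat l m) : ℝ := ∑ i, ∑ j, X i j * Y i j

lemma mul_eq_submatrix {l m : ℕ} {P : Matrix (Fin l) (Fin l) ℝ} {σ : Equiv.Perm (Fin l)}
    (h : ∀ i k, P i k = if σ i = k then 1 else 0) (X : Mat l m) :
    P * X = X.submatrix σ id := by
  ext i j
  simp [Matrix.mul_apply, h]

lemma exists_isPermMatrix (l : ℕ) (σ : Equiv.Perm (Fin l)) :
    ∃ P : Matrix (Fin l) (Fin l) ℝ, ∀ i k, P i k = if σ i = k then 1 else 0 :=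
  ⟨fun i k => if σ i = k then 1 else 0, fun _ _ => rfl⟩

lemma sum_sq_sub {l m : ℕ} (X Y : Mat l m) :
    ∑ i, ∑ j, ((X - Y) i j) ^ 2 = frobInner X X - 2 * frobInner X Y + frobInner Y Y := by
  simp only [frobInner, Finset.mul_sum, ← Finset.sum_sub_distrib, ← Finset.sum_add_distrib,
    Matrix.sub_apply]
  refine Finset.sum_congr rfl fun i _ => Finset.sum_congr rfl fun j _ => ?_
  ring

lemma frobInner_submatrix {l m : ℕ} (σ : Equiv.Perm (Fin l)) (X Y : Mat l m) :
    frobInner (X.submatrix σ id) (Y.submatrix σ id) = frobInner X Y :=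
  Equiv.sum_comp σ fun i => ∑ j, X i j * Y i j

lemma frobInner_convexComb_left {l m : ℕ} (t : ℝ) (X W Y : Mat l m) :
    frobInner ((1 - t) • X + t • W) Y = (1 - t) * frobInner X Y + t * frobInner W Y := by
  simp only [frobInner, Finset.mul_sum, ← Finset.sum_add_distrib, Matrix.add_apply,
    Matrix.smul_apply, smul_eq_mul]
  refine Finset.sum_congr rfl fun i _ => Finset.sum_congr rfl fun j _ => ?_
  ring

lemma IsLabeled.submatrix {l m : ℕ} {X : Mat l m} (hX : IsLabeled X)
    (σ : Equiv.Perm (Fin l)) : IsLabeled (X.submatrix σ id) :=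
  ⟨fun i j => hX.1 (σ i) j, fun j => (Equiv.sum_comp σ fun i => X i j).trans (hX.2 j)⟩

lemma IsLabeled.convexComb {l m : ℕ} {X W : Mat l m} (hX : IsLabeled X) (hW : IsLabeled W)
    {t : ℝ} (ht₀ : 0 ≤ t) (ht₁ : t ≤ 1) : IsLabeled ((1 - t) • X + t • W) := by
  refine ⟨fun i j => ?_, fun j => ?_⟩
  · obtain ⟨hX₀, hX₁⟩ := hX.1 i j
    obtain ⟨hW₀, hW₁⟩ := hW.1 i j
    simp only [Matrix.add_apply, Matrix.smul_apply, smul_eq_mul]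
    constructor <;> nlinarith
  · simp [Finset.sum_add_distrib, ← Finset.mul_sum, hX.2 j, hW.2 j]

/-- Permuting the rows of an asymmetric labeled partition nontrivially changes it. -/
lemma submatrix_ne_of_asym_pos {l m : ℕ} {Z : Set (Mat l m)} (hasym : 0 < asym Z)
    {Z' : Mat l m} (hZ' : Z' ∈ Z) {σ : Equiv.Perm (Fin l)} (hσ : σ ≠ 1) :
    Z'.submatrix σ id ≠ Z' := by
  intro hfix
  obtain ⟨P, hP⟩ := exists_isPermMatrix l σ
  have hP_ne : P ≠ 1 := by
    rintro rfl
    refine hσ (Equiv.ext fun i => ?_)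
    by_contra hi
    rw [Equiv.Perm.one_apply] at hi
    have hii := hP i i
    rw [Matrix.one_apply_eq, if_neg hi] at hii
    exact one_ne_zero hii
  have hle : asym Z ≤ 0 := by
    refine csInf_le ⟨0, ?_⟩ ⟨Z', hZ', P, ⟨σ, hP⟩, hP_ne, ?_⟩
    · rintro _ ⟨_, _, _, _, _, rfl⟩
      exact Real.sqrt_nonneg _
    · simp [mul_eq_submatrix hP, hfix, frobNorm]
  exact hle.not_gt hasym

/-- Points of the Dirichlet domain of `Z'` have maximal inner product with `Z'` among its
row permutations. -/
lemma frobInner_submatrix_le_of_mem_dirichlet {l m : ℕ} {Z' : Mat l m} {X : LabeledSpace l m}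
    (hX : X ∈ dirichlet Z') (σ : Equiv.Perm (Fin l)) :
    frobInner X.1 (Z'.submatrix σ id) ≤ frobInner X.1 Z' := by
  obtain ⟨P, hP⟩ := exists_isPermMatrix l σ
  have h := hX P ⟨σ, hP⟩
  rw [mul_eq_submatrix hP, frobNorm, frobNorm, Real.sqrt_le_sqrt_iff (by positivity),
    sum_sq_sub, sum_sq_sub, frobInner_submatrix] at h
  linarith

lemma frobInner_lt_frobInner_self {l m : ℕ} {W Z : Mat l m} (hne : W ≠ Z)
    (heq : frobInner W W = frobInner Z Z) : frobInner W Z < frobInner W W := by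
  have hpos : 0 < ∑ i, ∑ j, ((W - Z) i j) ^ 2 := by
    refine lt_of_le_of_ne (by positivity) fun h => hne ?_
    ext i j
    have hi := (Finset.sum_eq_zero_iff_of_nonneg fun i _ => by positivity).1 h.symm i
      (Finset.mem_univ i)
    have hij := (Finset.sum_eq_zero_iff_of_nonneg fun j _ => by positivity).1 hi j
      (Finset.mem_univ j)
    exact sub_eq_zero.1 (pow_eq_zero_iff two_ne_zero |>.1 hij)
  rw [sum_sq_sub] at hpos
  linarith

/-- A point of `𝒳` that is at least as close to some other representation of an asymmetric
partition as to `Z'` is not interior to the Dirichlet domain of `Z'`. -/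
lemma notMem_interior_dirichlet {l m : ℕ} {Z' : Mat l m} (hZ' : IsLabeled Z')
    {σ : Equiv.Perm (Fin l)} (hne : Z'.submatrix σ id ≠ Z') {X : LabeledSpace l m}
    (hX : frobInner X.1 Z' ≤ frobInner X.1 (Z'.submatrix σ id)) :
    X ∉ interior (dirichlet Z') := by
  intro hint
  set W := Z'.submatrix σ id
  have hlt : frobInner W Z' < frobInner W W :=
    frobInner_lt_frobInner_self hne (frobInner_submatrix σ Z' Z')
  let γ : unitInterval → LabeledSpace l m := fun t =>
    ⟨(1 - t.1) • X.1 + t.1 • W, X.2.convexComb (hZ'.submatrix σ) t.2.1 t.2.2⟩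
  have hγ : Continuous γ := by
    refine Continuous.subtype_mk ?_ _
    fun_prop
  have hγ_zero : γ 0 = X := Subtype.ext (by simp [γ])
  let u : ℕ → unitInterval := fun n => ⟨1 / ((n : ℝ) + 1), by positivity, by
    rw [div_le_one (by positivity)]
    linarith [(Nat.cast_nonneg n : (0 : ℝ) ≤ n)]⟩
  have hu : Filter.Tendsto u Filter.atTop (nhds 0) :=
    tendsto_subtype_rng.2 tendsto_one_div_add_atTop_nhds_zero_nat
  have hev := (hγ.tendsto' 0 X hγ_zero).comp hu (mem_interior_iff_mem_nhds.1 hint)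
  obtain ⟨n, hn⟩ := Filter.Eventually.exists (Filter.mem_map.1 hev)
  have hle := frobInner_submatrix_le_of_mem_dirichlet hn σ
  have ht : 0 < (u n).1 := by
    change 0 < 1 / ((n : ℝ) + 1)
    positivity
  change frobInner ((1 - (u n).1) • X.1 + (u n).1 • W) W ≤
    frobInner ((1 - (u n).1) • X.1 + (u n).1 • W) Z' at hle
  rw [frobInner_convexComb_left, frobInner_convexComb_left] at hle
  have := mul_le_mul_of_nonneg_left hX (sub_nonneg.2 (u n).2.2)
  have := mul_lt_mul_of_pos_left hlt ht
  linarith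

lemma mem_orbit_self {l m : ℕ} (X : Mat l m) : X ∈ orbit X :=
  ⟨1, ⟨1, fun i k => by
    rw [Matrix.one_apply]
    rfl⟩, by simp⟩

lemma IsLabeled.of_mem_partitionSpace {l m : ℕ} {Z : Set (Mat l m)}
    (hZ : Z ∈ PartitionSpace l m) {Z' : Mat l m} (hZ' : Z' ∈ Z) : IsLabeled Z' := by
  obtain ⟨Y, hY, rfl⟩ := hZ
  obtain ⟨P, ⟨σ, hP⟩, rfl⟩ := hZ'
  rw [mul_eq_submatrix hP]
  exact hY.submatrix σ

lemma mem_frontier_dirichlet {l m : ℕ} {Z : Set (Mat l m)} (hZ : Z ∈ PartitionSpace l m)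
    (hasym : 0 < asym Z) {Z' : Mat l m} (hZ' : Z' ∈ Z) {X' X'' : LabeledSpace l m}
    (horb : X''.1 ∈ orbit X'.1) (hne : X'.1 ≠ X''.1)
    (hX' : X' ∈ dirichlet Z') (hX'' : X'' ∈ dirichlet Z') :
    X' ∈ frontier (dirichlet Z') := by
  obtain ⟨P, ⟨σ, hP⟩, hPX⟩ := horb
  rw [mul_eq_submatrix hP] at hPX
  have hσ : σ⁻¹ ≠ 1 := by
    rw [Ne, inv_eq_one]
    rintro rfl
    exact hne (by rw [hPX]; rfl)
  refine ⟨subset_closure hX', notMem_interior_dirichlet (.of_mem_partitionSpace hZ hZ')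
    (submatrix_ne_of_asym_pos hasym hZ' hσ) ?_⟩
  have hle := frobInner_submatrix_le_of_mem_dirichlet hX'' σ
  have hinv : (Z'.submatrix (σ⁻¹ : Equiv.Perm (Fin l)) id).submatrix σ id = Z' := by
    ext i j
    simp
  rw [hPX, frobInner_submatrix] at hle
  calc frobInner X'.1 Z' ≤ frobInner (X'.1.submatrix σ id) Z' := hle
    _ = frobInner X'.1 (Z'.submatrix (σ⁻¹ : Equiv.Perm (Fin l)) id) := by
      rw [← frobInner_submatrix σ X'.1, hinv]

/-- Let `Z'` represent an asymmetric partition `Z` and let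
`D_{Z'}` be its Dirichlet fundamental domain.  If `X'` and `X''` are two
distinct representations of the same partition and both lie in `D_{Z'}`, then
both lie in the boundary `∂D_{Z'}` (relative to the subspace topology on 𝒳). -/
theorem dirichlet_two_representations_in_boundary (l m : ℕ) (hl : 1 ≤ l) (hm : 1 ≤ m)
    (Z : Set (Mat l m)) (hZ : Z ∈ PartitionSpace l m) (hasym : 0 < asym Z)
    (Z' : Mat l m) (hZ' : Z' ∈ Z)
    (X' X'' : LabeledSpace l m) (horb : orbit X'.1 = orbit X''.1)
    (hne : X'.1 ≠ X''.1)
    (hX' : X' ∈ dirichlet Z') (hX'' : X'' ∈ dirichlet Z') :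
    X' ∈ frontier (dirichlet Z') ∧ X'' ∈ frontier (dirichlet Z') := by
  exact ⟨mem_frontier_dirichlet hZ hasym hZ' (horb ▸ mem_orbit_self X''.1) hne hX' hX'',
    mem_frontier_dirichlet hZ hasym hZ' (horb ▸ mem_orbit_self X'.1) hne.symm hX'' hX'⟩

end CJT
end
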